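/- Let s ≥ 1, let Ã, A : Fin s → Fin s → ℝ with Ã strictly lower triangular (Ã i j = 0 for j ≥ i) and A lower triangular (A i j = 0 for j > i), let Δt > 0, and fix a stage index i : Fin s. Let d ≥ 1, g > 0, k > 0, η ∈ ℝ, let b be differentiable, let hⁿ and stage values h⁽¹⁾, …, h⁽ⁱ⁾ be positive differentiable functions and q⁽¹⁾, …, q⁽ⁱ⁾ differentiable vector fields with each Φ(h⁽ʲ⁾) differentiable for j ≤ i. Assume for every x: (i) h⁽ⁱ⁾(x) = hⁿ(x) − Δt·∑_{j<i} Ã i j·(div q⁽ʲ⁾(x) + div Φ(h⁽ʲ⁾)(x)) + Δt·∑_{j≤i} A i j·div Φ(h⁽ʲ⁾)(x); (ii) ∇((g/2)·(h⁽ⁱ⁾)²)(x) + g·h⁽ⁱ⁾(x)·∇b(x) + (g·k²·‖q⁽ⁱ⁾(x)‖/(h⁽ⁱ⁾(x))^η) • q⁽ⁱ⁾(x) = 0; and (iii) q⁽ʲ⁾(x) = −Φ(h⁽ʲ⁾)(x) for all j < i. Then for every x: q⁽ⁱ⁾(x) = −Φ(h⁽ⁱ⁾)(x) and h⁽ⁱ⁾(x)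 = hⁿ(x) + Δt·∑_{j≤i} A i j·div Φ(h⁽ʲ⁾)(x); i.e., in the limit ε → 0 the i-th stage of the IMEX Runge–Kutta scheme coincides with the i-th stage of the diagonally implicit Runge–Kutta method given by A applied to the limiting diffusion equation ∂ₜh = ∇·Φ(h) (the induction step in the proof of the asymptotic-accuracy Theorem 3.2 of the paper). -/

import Mathlib

open scoped BigOperators

/-- Divergence of a vector field on `EuclideanSpace ℝ (Fin d)`:
`div F (x) = ∑ i, ∂ᵢ Fᵢ (x)`. -/
noncomputable def ediv {d : ℕ} (F : EuclideanSpace ℝ (Fin d) → EuclideanSpace ℝ (Fin d))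
    (x : EuclideanSpace ℝ (Fin d)) : ℝ :=
  ∑ i, fderiv ℝ F x (EuclideanSpace.single i 1) i

/-- The limiting (Darcy-type) flux `Φ(h)(x) = √(h^(η+1)/k²) ‖∇H‖^(−1/2) • ∇H`, `H = h + b`,
with the convention `Φ(h)(x) = 0` when `∇H(x) = 0` (automatic since `0 ^ (−1/2) = 0`
for the real power). -/
noncomputable def limFlux {d : ℕ} (k η : ℝ)
    (b h : EuclideanSpace ℝ (Fin d) → ℝ) (x : EuclideanSpace ℝ (Fin d)) :
    EuclideanSpace ℝ (Fin d) :=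
  (Real.sqrt ((h x) ^ (η + 1) / k ^ 2)
      * ‖gradient (fun y => h y + b y) x‖ ^ (-(1 : ℝ) / 2)) •
    gradient (fun y => h y + b y) x

/-- The only solution of the quadratic friction law `‖q‖ q = -c v`. -/
lemma eq_neg_smul_of_norm_smul_self_eq {V : Type*} [NormedAddCommGroup V] [NormedSpace ℝ V]
    {q v : V} {c : ℝ} (hc : 0 < c) (h : ‖q‖ • q = -(c • v)) :
    q = -((√c * ‖v‖ ^ (-(1 : ℝ) / 2)) • v) := by
  have hnorm : ‖q‖ * ‖q‖ = c * ‖v‖ := by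
    simpa [norm_smul, abs_of_pos hc] using congrArg norm h
  rcases eq_or_ne v 0 with rfl | hv
  · simpa using hnorm
  have hv' : 0 < ‖v‖ := norm_pos_iff.2 hv
  have hq : ‖q‖ = √c * √‖v‖ := by
    rw [← Real.sqrt_mul hc.le, ← hnorm, Real.sqrt_mul_self (norm_nonneg q)]
  have hq0 : ‖q‖ ≠ 0 := by rw [hq]; positivity
  have hpow : ‖v‖ ^ (-(1 : ℝ) / 2) = (√‖v‖)⁻¹ := by
    rw [neg_div, Real.rpow_neg hv'.le, ← Real.sqrt_eq_rpow]
  apply smul_right_injective V hq0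
  change ‖q‖ • q = ‖q‖ • -_
  rw [h, smul_neg, smul_smul, hpow, hq]
  congr 2
  have hsv : √‖v‖ ≠ 0 := by positivity
  field_simp
  rw [Real.sq_sqrt hc.le]

lemma gradient_fun_add {F : Type*} [NormedAddCommGroup F] [InnerProductSpace ℝ F]
    [CompleteSpace F] {f₁ f₂ : F → ℝ} {x : F} (h₁ : DifferentiableAt ℝ f₁ x)
    (h₂ : DifferentiableAt ℝ f₂ x) :
    gradient (fun y => f₁ y + f₂ y) x = gradient f₁ x + gradient f₂ x := by
  simp only [gradient, fderiv_fun_add h₁ h₂, map_add]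

lemma gradient_half_mul_sq {F : Type*} [NormedAddCommGroup F] [InnerProductSpace ℝ F]
    [CompleteSpace F] {f : F → ℝ} {x : F} (g : ℝ) (hf : DifferentiableAt ℝ f x) :
    gradient (fun y => g / 2 * f y ^ 2) x = (g * f x) • gradient f x := by
  have hd : fderiv ℝ (fun y => g / 2 * f y ^ 2) x = (g * f x) • fderiv ℝ f x := by
    rw [((hf.hasFDerivAt.pow 2).const_mul (g / 2)).fderiv, smul_smul]
    congr 1
    norm_num
    ring
  simp [gradient, hd]

lemma ediv_neg {d : ℕ} (F : EuclideanSpace ℝ (Fin d) → EuclideanSpace ℝ (Fin d))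
    (x : EuclideanSpace ℝ (Fin d)) : ediv (fun y => -F y) x = -ediv F x := by
  simp [ediv, fderiv_fun_neg]

/-- The momentum balance in the limit determines the discharge as minus the limiting flux. -/
lemma eq_neg_limFlux_of_momentum {d : ℕ} {g k η : ℝ} (hg : 0 < g) (hk : 0 < k)
    {b h : EuclideanSpace ℝ (Fin d) → ℝ} {x q : EuclideanSpace ℝ (Fin d)}
    (hb : DifferentiableAt ℝ b x) (hh : DifferentiableAt ℝ h x) (hpos : 0 < h x)
    (hmom : gradient (fun y => (g / 2) * (h y) ^ 2) x + (g * h x) • gradient b x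
      + (g * k ^ 2 * ‖q‖ / (h x) ^ η) • q = 0) :
    q = -limFlux k η b h x := by
  have hη : 0 < h x ^ η := Real.rpow_pos_of_pos hpos η
  apply eq_neg_smul_of_norm_smul_self_eq (by positivity)
  rw [gradient_half_mul_sq g hh, ← smul_add, ← gradient_fun_add hh hb] at hmom
  have ha : g * k ^ 2 / h x ^ η ≠ 0 := by positivity
  apply smul_right_injective _ ha
  simp only [smul_neg, smul_smul]
  have hcoef : g * k ^ 2 / h x ^ η * (h x ^ (η + 1) / k ^ 2) = g * h x := by
    rw [Real.rpow_add_one hpos.ne']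
    field_simp
  rw [hcoef, div_mul_eq_mul_div]
  exact eq_neg_of_add_eq_zero_right hmom

/-- Induction step of the asymptotic-accuracy theorem (Theorem 3.2): in the formal limit
`ε → 0`, if the previous stages are well-prepared (`q⁽ʲ⁾ = −Φ(h⁽ʲ⁾)` for `j < i`), then the
`i`-th stage of the IMEX Runge–Kutta scheme satisfies `q⁽ⁱ⁾ = −Φ(h⁽ⁱ⁾)` and coincides with
the `i`-th stage of the diagonally implicit Runge–Kutta method given by `A` applied to the
limiting diffusion equation `∂ₜh = ∇·Φ(h)`. -/
theorem imex_stage_is_dirk_stage_in_limit (s : ℕ) (hs : 1 ≤ s)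
    (Atil A : Fin s → Fin s → ℝ)
    (hAtil : ∀ i j : Fin s, i ≤ j → Atil i j = 0)
    (hA_lower : ∀ i j : Fin s, i < j → A i j = 0)
    (Δt : ℝ) (hΔt : 0 < Δt) (i : Fin s)
    (d : ℕ) (hd : 1 ≤ d)
    (g k η : ℝ) (hg : 0 < g) (hk : 0 < k)
    (b : EuclideanSpace ℝ (Fin d) → ℝ) (hb : Differentiable ℝ b)
    (hn : EuclideanSpace ℝ (Fin d) → ℝ)
    (hn_pos : ∀ x, 0 < hn x) (hn_diff : Differentiable ℝ hn)
    (hst : Fin s → EuclideanSpace ℝ (Fin d) → ℝ)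
    (qst : Fin s → EuclideanSpace ℝ (Fin d) → EuclideanSpace ℝ (Fin d))
    (hst_pos : ∀ j : Fin s, j ≤ i → ∀ x, 0 < hst j x)
    (hst_diff : ∀ j : Fin s, j ≤ i → Differentiable ℝ (hst j))
    (qst_diff : ∀ j : Fin s, j ≤ i → Differentiable ℝ (qst j))
    (Φ_diff : ∀ j : Fin s, j ≤ i → Differentiable ℝ (limFlux k η b (hst j)))
    (stage_mass : ∀ x,
      hst i x = hn x
        - Δt * ∑ j ∈ Finset.univ.filter (fun j => j < i),
            Atil i j * (ediv (qst j) x + ediv (limFlux k η b (hst j)) x)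
        + Δt * ∑ j ∈ Finset.univ.filter (fun j => j ≤ i),
            A i j * ediv (limFlux k η b (hst j)) x)
    (stage_momentum : ∀ x,
      gradient (fun y => (g / 2) * (hst i y) ^ 2) x
        + (g * hst i x) • gradient b x
        + (g * k ^ 2 * ‖qst i x‖ / (hst i x) ^ η) • qst i x = 0)
    (well_prepared : ∀ j : Fin s, j < i → ∀ x, qst j x = -limFlux k η b (hst j) x) :
    (∀ x, qst i x = -limFlux k η b (hst i) x) ∧
    (∀ x, hst i x = hn x
        + Δt * ∑ j ∈ Finset.univ.filter (fun j => j ≤ i),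
            A i j * ediv (limFlux k η b (hst j)) x) := by
  refine ⟨fun x => eq_neg_limFlux_of_momentum hg hk (hb x) (hst_diff i le_rfl x)
    (hst_pos i le_rfl x) (stage_momentum x), fun x => ?_⟩
  have hexpl : ∑ j ∈ Finset.univ.filter (fun j => j < i),
      Atil i j * (ediv (qst j) x + ediv (limFlux k η b (hst j)) x) = 0 := by
    refine Finset.sum_eq_zero fun j hj => ?_
    rw [funext (well_prepared j (Finset.mem_filter.1 hj).2), ediv_neg, neg_add_cancel, mul_zero]
  simpa [hexpl] using stage_mass x
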